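/- Let R be a commutative ring and I an ideal of R generated by an idempotent element e (I = Re). Then the map π : R → R⋈I defined by π(r) = (r, r(1-e)) is an R⋈I-module homomorphism splitting the surjection ε : R⋈I → R, (r, r+i) ↦ r; that is, ε ∘ π = id_R. -/

import Mathlib

/-- The amalgamated duplication of a commutative ring `R` along an ideal `I`,
realized as the subring `{(x, y) ∈ R × R : y - x ∈ I}` of `R × R`. -/
def amalgDup (R : Type*) [CommRing R] (I : Ideal R) : Subring (R × R) where
  carrier := {p | p.2 - p.1 ∈ I}
  zero_mem' := by simp
  one_mem' := by simp
  add_mem' := by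
    intro a b ha hb
    have := I.add_mem ha hb
    simpa [add_sub_add_comm] using this
  neg_mem' := by
    intro a ha
    show -a.2 - -a.1 ∈ I
    have h : -a.2 - -a.1 = -(a.2 - a.1) := by ring
    rw [h]; exact I.neg_mem ha
  mul_mem' := by
    intro a b ha hb
    have : a.2 * b.2 - a.1 * b.1 = (a.2 - a.1) * b.2 + a.1 * (b.2 - b.1) := by ring
    show a.2 * b.2 - a.1 * b.1 ∈ I
    rw [this]
    exact I.add_mem (I.mul_mem_right _ ha) (I.mul_mem_left _ hb)

/-- A commutative ring is quasi-Frobenius if it is Noetherian and self-injective. -/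
def IsQuasiFrobenius (R : Type*) [CommRing R] : Prop :=
  IsNoetherianRing R ∧ Module.Injective R R

/-- The canonical surjection `ε : R⋈I → R`, `(r, r+i) ↦ r`. -/
def epsHom (R : Type*) [CommRing R] (I : Ideal R) : amalgDup R I →+* R :=
  (RingHom.fst R R).comp (amalgDup R I).subtype

/-- `R` as a module over `R⋈I` via the surjection `ε`. -/
instance epsModule (R : Type*) [CommRing R] (I : Ideal R) :
    Module (amalgDup R I) R :=
  Module.compHom R (epsHom R I)

theorem exists_section_of_span_idempotent (R : Type*) [CommRing R] (e : R)
    (he : e * e = e) :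
    ∃ π : R →ₗ[amalgDup R (Ideal.span {e})] amalgDup R (Ideal.span {e}),
      (∀ r : R, (π r : R × R) = (r, r * (1 - e))) ∧
      ∀ r : R, epsHom R (Ideal.span {e}) (π r) = r := by
  have mul_one_sub_eq (x : amalgDup R (Ideal.span {e})) (r : R) :
      x.1.1 * r * (1 - e) = x.1.2 * (r * (1 - e)) := by
    obtain ⟨c, hc⟩ := Ideal.mem_span_singleton'.mp (show x.1.2 - x.1.1 ∈ Ideal.span {e} from x.2)
    linear_combination (r * c) * he + (r * (1 - e)) * hc
  refine ⟨{ toFun := fun r => ⟨(r, r * (1 - e)), ?_⟩, map_add' := ?_, map_smul' := ?_ },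
    fun _ => rfl, fun _ => rfl⟩
  · exact Ideal.mem_span_singleton'.mpr ⟨-r, by ring⟩
  · intro r s
    exact Subtype.ext (Prod.ext rfl (add_mul r s (1 - e)))
  · intro x r
    exact Subtype.ext (Prod.ext rfl (mul_one_sub_eq x r))
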